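/- Let K be a field, q ∈ K[x_1] nonconstant, R̄ = K[x_1]/⟨q⟩, fix a monomial ordering on the x̃-monomials, let J be an ideal of R̄[x̃] and let B = {b_1,…,b_s} ⊆ J be a finite set of nonconstant polynomials (B ⊂ R̄[x̃] \ R̄). Then the identity of ideals ⟨{lt(f) : f ∈ J \ {0}}⟩ = ⟨{lt(b) : b ∈ B}⟩ holds in R̄[x̃] if and only if for every f ∈ R̄[x̃] one has: f ∈ J exactly when f admits a gcd-reduction to zero by B, i.e. there exist a unit λ ∈ R̄^× and h_1,…,h_s ∈ R̄[x̃] with λ·f = Σ_{j=1}^s h_j·b_j and lm(f) = max_j lm(h_j)·lm(b_j), the maximum being over the nonzero h_j. -/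

import Mathlib

open MvPolynomial

/-- A monomial ordering on the monomials (exponent vectors) in `m` variables:
a well-ordering compatible with addition of exponents. -/
structure MonomialOrdering (m : ℕ) where
  lin : LinearOrder (Fin m →₀ ℕ)
  wf : WellFounded lin.lt
  add_lt_add : ∀ a b c : Fin m →₀ ℕ, lin.lt a b → lin.lt (a + c) (b + c)

variable {m : ℕ}

open Classical in
/-- Leading monomial of `f` (junk value `0` for `f = 0`). -/
noncomputable def lmon {R : Type*} [CommRing R] (mo : MonomialOrdering m)
    (f : MvPolynomial (Fin m) R) : Fin m →₀ ℕ :=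
  letI := mo.lin
  if h : f = 0 then 0
  else f.support.max' (Finset.nonempty_iff_ne_empty.mpr
    (fun he => h (MvPolynomial.support_eq_empty.mp he)))

/-- Leading coefficient of `f`. -/
noncomputable def lcoeff {R : Type*} [CommRing R] (mo : MonomialOrdering m)
    (f : MvPolynomial (Fin m) R) : R :=
  f.coeff (lmon mo f)

/-- Leading term of `f`, as a polynomial. -/
noncomputable def lterm {R : Type*} [CommRing R] (mo : MonomialOrdering m)
    (f : MvPolynomial (Fin m) R) : MvPolynomial (Fin m) R :=
  MvPolynomial.monomial (lmon mo f) (lcoeff mo f)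

/-- `f` is a nonconstant polynomial, i.e. `f ∉ R`. -/
def Nonconst {R : Type*} [CommRing R] (f : MvPolynomial (Fin m) R) : Prop :=
  ∀ c : R, f ≠ MvPolynomial.C c

section LeadingTerms

variable {R : Type*} [CommRing R] (mo : MonomialOrdering m)

theorem MonomialOrdering.add_le_add {a b c d : Fin m →₀ ℕ} (hab : mo.lin.le a b)
    (hcd : mo.lin.le c d) : mo.lin.le (a + c) (b + d) := by
  have right (x y z : Fin m →₀ ℕ) (h : mo.lin.le x y) : mo.lin.le (x + z) (y + z) := by
    rcases @lt_or_eq_of_le _ mo.lin.toPartialOrder _ _ h with h | rfl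
    · exact @le_of_lt _ mo.lin.toPartialOrder.toPreorder _ _ (mo.add_lt_add x y z h)
    · exact mo.lin.le_refl _
  refine mo.lin.le_trans _ _ _ (right a b c hab) ?_
  rw [add_comm b c, add_comm b d]
  exact right c d b hcd

theorem lmon_mem_support {f : MvPolynomial (Fin m) R} (hf : f ≠ 0) :
    lmon mo f ∈ f.support := by
  let := mo.lin
  rw [lmon, dif_neg hf]
  exact Finset.max'_mem _ _

theorem lcoeff_ne_zero {f : MvPolynomial (Fin m) R} (hf : f ≠ 0) : lcoeff mo f ≠ 0 :=
  mem_support_iff.mp (lmon_mem_support mo hf)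

theorem le_lmon {f : MvPolynomial (Fin m) R} {s : Fin m →₀ ℕ} (hs : s ∈ f.support) :
    mo.lin.le s (lmon mo f) := by
  let := mo.lin
  have hf : f ≠ 0 := by rintro rfl; simp at hs
  rw [lmon, dif_neg hf]
  exact Finset.le_max' _ _ hs

theorem add_le_of_mem_support_mul {f g : MvPolynomial (Fin m) R} {a s : Fin m →₀ ℕ}
    (hf : ∀ t ∈ f.support, mo.lin.le (t + lmon mo g) a) (hs : s ∈ (f * g).support) :
    mo.lin.le s a := by
  classical
  obtain ⟨t, ht, u, hu, rfl⟩ := Finset.mem_add.mp (support_mul f g hs)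
  exact mo.lin.le_trans _ _ _ (mo.add_le_add (mo.lin.le_refl t) (le_lmon mo hu)) (hf t ht)

/-- A product whose factor `f` satisfies `t + lm g ≤ a` on its support has coefficient
`f_t · lc g` at `a = t + lm g`. -/
theorem coeff_mul_eq_of_add_lmon_eq {f g : MvPolynomial (Fin m) R} {a t : Fin m →₀ ℕ}
    (hf : ∀ u ∈ f.support, mo.lin.le (u + lmon mo g) a) (ht : t + lmon mo g = a) :
    (f * g).coeff a = f.coeff t * lcoeff mo g := by
  classical
  rw [coeff_mul, _root_.lcoeff]
  refine Finset.sum_eq_single (t, lmon mo g) ?_ ?_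
  · rintro ⟨u, v⟩ huv hne
    replace huv : u + v = a := Finset.HasAntidiagonal.mem_antidiagonal.mp huv
    by_contra h0
    have hu : u ∈ f.support := mem_support_iff.mpr (left_ne_zero_of_mul h0)
    have hv : v ∈ g.support := mem_support_iff.mpr (right_ne_zero_of_mul h0)
    rcases @lt_or_eq_of_le _ mo.lin.toPartialOrder _ _ (le_lmon mo hv) with hlt | rfl
    · have h1 := mo.add_lt_add _ _ u hlt
      rw [add_comm v u, add_comm _ u, huv] at h1
      exact @not_lt_of_ge _ mo.lin.toPartialOrder.toPreorder _ _ (hf u hu) h1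
    · exact hne (by rw [add_right_cancel (huv.trans ht.symm)])
  · intro h
    exact absurd (Finset.HasAntidiagonal.mem_antidiagonal.mpr ht) h

/-- If no exponent of `f` reaches `a` when added to `lm g`, the coefficient at `a` vanishes. -/
theorem coeff_mul_eq_zero_of_add_lmon_ne {f g : MvPolynomial (Fin m) R} {a : Fin m →₀ ℕ}
    (hf : ∀ u ∈ f.support, mo.lin.le (u + lmon mo g) a)
    (hne : ∀ t ∈ f.support, t + lmon mo g ≠ a) : (f * g).coeff a = 0 := by
  classical
  by_contra h0
  obtain ⟨u, hu, v, hv, rfl⟩ := Finset.mem_add.mp (support_mul f g (mem_support_iff.mpr h0))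
  have h1 := mo.add_le_add (mo.lin.le_refl u) (le_lmon mo hv)
  exact hne u hu (mo.lin.le_antisymm _ _ (hf u hu) h1)

theorem coeff_mul_lterm {f g : MvPolynomial (Fin m) R} {a : Fin m →₀ ℕ}
    (hf : ∀ u ∈ f.support, mo.lin.le (u + lmon mo g) a) :
    (f * g).coeff a = (f * lterm mo g).coeff a := by
  classical
  rw [lterm, coeff_mul_monomial']
  split_ifs with hle
  · exact coeff_mul_eq_of_add_lmon_eq mo hf (tsub_add_cancel_of_le hle)
  · refine coeff_mul_eq_zero_of_add_lmon_ne mo hf fun t _ ht => hle ?_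
    rw [← ht]
    exact le_add_self

theorem support_add_lmon_le_iff {f : MvPolynomial (Fin m) R} {a c : Fin m →₀ ℕ} :
    (∀ u ∈ f.support, mo.lin.le (u + c) a) ↔ (f ≠ 0 → mo.lin.le (lmon mo f + c) a) :=
  ⟨fun h hf => h _ (lmon_mem_support mo hf), fun h u hu =>
    mo.lin.le_trans _ _ _ (mo.add_le_add (le_lmon mo hu) (mo.lin.le_refl c))
      (h (by rintro rfl; simp at hu))⟩

/-- The top terms of a combination of the elements of `B` realizing `lt f`. -/
theorem exists_reduction_step {B : Finset (MvPolynomial (Fin m) R)}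
    {f : MvPolynomial (Fin m) R}
    (hlt : lterm mo f ∈ Ideal.span ((fun b => lterm mo b) '' (B : Set (MvPolynomial (Fin m) R)))) :
    ∃ g : MvPolynomial (Fin m) R → MvPolynomial (Fin m) R,
      (∀ b ∈ B, ∀ u ∈ (g b).support, mo.lin.le (u + lmon mo b) (lmon mo f)) ∧
      (∑ b ∈ B, g b * b).coeff (lmon mo f) = lcoeff mo f := by
  classical
  obtain ⟨c, hc⟩ := (Submodule.mem_span_image_finset_iff_exists_fun' _).mp hlt
  let g : MvPolynomial (Fin m) R → MvPolynomial (Fin m) R := fun b =>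
    if lmon mo b ≤ lmon mo f then
      monomial (lmon mo f - lmon mo b) ((c b).coeff (lmon mo f - lmon mo b)) else 0
  have hg : ∀ b ∈ B, ∀ u ∈ (g b).support, mo.lin.le (u + lmon mo b) (lmon mo f) := by
    intro b _ u hu
    by_cases hle : lmon mo b ≤ lmon mo f
    · simp only [g, if_pos hle] at hu
      rw [Finset.mem_singleton.mp (support_monomial_subset hu), tsub_add_cancel_of_le hle]
      exact mo.lin.le_refl _
    · simp [g, if_neg hle] at hu
  refine ⟨g, hg, ?_⟩
  have hf : lcoeff mo f = (lterm mo f).coeff (lmon mo f) := by simp [lterm]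
  rw [hf, ← hc, coeff_sum, coeff_sum]
  refine Finset.sum_congr rfl fun b hb => ?_
  rw [coeff_mul_lterm mo (hg b hb), smul_eq_mul, lterm, coeff_mul_monomial', coeff_mul_monomial']
  split_ifs with hle
  · simp [g, if_pos hle]
  · rfl

/-- Division with remainder zero for ideals whose leading terms are generated by those of `B`. -/
theorem exists_standard_representation {J : Ideal (MvPolynomial (Fin m) R)}
    {B : Finset (MvPolynomial (Fin m) R)} (hBJ : ∀ b ∈ B, b ∈ J)
    (hlt : ∀ f ∈ J, f ≠ 0 →
      lterm mo f ∈ Ideal.span ((fun b => lterm mo b) '' (B : Set (MvPolynomial (Fin m) R))))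
    (f : MvPolynomial (Fin m) R) (hfJ : f ∈ J) :
    ∃ h : MvPolynomial (Fin m) R → MvPolynomial (Fin m) R,
      f = ∑ b ∈ B, h b * b ∧
      ∀ b ∈ B, ∀ u ∈ (h b).support, mo.lin.le (u + lmon mo b) (lmon mo f) := by
  classical
  induction hα : lmon mo f using mo.wf.induction generalizing f with
  | _ α ih =>
  subst hα
  by_cases hf : f = 0
  · exact ⟨fun _ => 0, by simp [hf], by simp⟩
  obtain ⟨g, hg, hgc⟩ := exists_reduction_step mo (hlt f hfJ hf)
  set r := f - ∑ b ∈ B, g b * b with hr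
  have hrJ : r ∈ J := sub_mem hfJ (sum_mem fun b hb => J.mul_mem_left _ (hBJ b hb))
  by_cases hr0 : r = 0
  · exact ⟨g, sub_eq_zero.mp hr0, hg⟩
  have hmem := lmon_mem_support mo hr0
  have hle : mo.lin.le (lmon mo r) (lmon mo f) := by
    rcases Finset.mem_union.mp (support_sub _ _ _ hmem) with h | h
    · exact le_lmon mo h
    · obtain ⟨b, hb, hs⟩ := Finset.mem_biUnion.mp (support_sum h)
      exact add_le_of_mem_support_mul mo (hg b hb) hs
  have hne : lmon mo r ≠ lmon mo f := by
    intro he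
    rw [mem_support_iff, he, hr, coeff_sub, hgc] at hmem
    exact hmem (sub_self _)
  have hlt' : mo.lin.lt (lmon mo r) (lmon mo f) :=
    @lt_of_le_of_ne _ mo.lin.toPartialOrder _ _ hle hne
  obtain ⟨h, hh, hhle⟩ := ih _ hlt' r hrJ rfl
  refine ⟨fun b => h b + g b, ?_, fun b hb u hu => ?_⟩
  · simp only [add_mul, Finset.sum_add_distrib, ← hh, hr, sub_add_cancel]
  · rcases Finset.mem_union.mp (support_add hu) with hu | hu
    · exact mo.lin.le_trans _ _ _ (hhle b hb u hu) hle
    · exact hg b hb u hu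

/-- The coefficient comparison at `lm f` in a representation of `f` puts `lt f` into the ideal
generated by the leading terms of `B`. -/
theorem lterm_mem_span_of_representation {B : Finset (MvPolynomial (Fin m) R)}
    {f : MvPolynomial (Fin m) R} {lam : R} (hlam : IsUnit lam)
    {h : MvPolynomial (Fin m) R → MvPolynomial (Fin m) R}
    (hsum : C lam * f = ∑ b ∈ B, h b * b)
    (hle : ∀ b ∈ B, ∀ u ∈ (h b).support, mo.lin.le (u + lmon mo b) (lmon mo f)) :
    lterm mo f ∈
      Ideal.span ((fun b => lterm mo b) '' (B : Set (MvPolynomial (Fin m) R))) := by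
  classical
  obtain ⟨u, rfl⟩ := hlam
  have hcoeff : lcoeff mo f = ↑u⁻¹ * ∑ b ∈ B, (h b * lterm mo b).coeff (lmon mo f) := by
    rw [← Finset.sum_congr rfl fun b hb => coeff_mul_lterm mo (hle b hb), ← coeff_sum, ← hsum,
      coeff_C_mul, Units.inv_mul_cancel_left, _root_.lcoeff]
  rw [lterm, hcoeff, ← C_mul_monomial, map_sum]
  refine Ideal.mul_mem_left _ _ (sum_mem fun b hb => ?_)
  rw [lterm, coeff_mul_monomial']
  split_ifs with hb'
  · rw [← tsub_add_cancel_of_le hb', add_tsub_cancel_right, ← monomial_mul]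
    exact Ideal.mul_mem_left _ _ (Ideal.subset_span ⟨b, hb, rfl⟩)
  · simp

theorem lterm_span_eq_iff_mem_iff_representation (J : Ideal (MvPolynomial (Fin m) R))
    (B : Finset (MvPolynomial (Fin m) R)) (hBJ : ∀ b ∈ B, b ∈ J) (hB0 : ∀ b ∈ B, b ≠ 0) :
    (Ideal.span {p : MvPolynomial (Fin m) R | ∃ f ∈ J, f ≠ 0 ∧ p = lterm mo f}
      = Ideal.span ((fun b => lterm mo b) '' (B : Set (MvPolynomial (Fin m) R)))) ↔
    (∀ f : MvPolynomial (Fin m) R,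
      f ∈ J ↔
        ∃ (lam : R) (h : MvPolynomial (Fin m) R → MvPolynomial (Fin m) R),
          IsUnit lam ∧
          C lam * f = ∑ b ∈ B, h b * b ∧
          (∀ b ∈ B, h b ≠ 0 → mo.lin.le (lmon mo (h b) + lmon mo b) (lmon mo f)) ∧
          (f ≠ 0 → ∃ b ∈ B, h b ≠ 0 ∧ lmon mo (h b) + lmon mo b = lmon mo f)) := by
  constructor
  · intro hspan f
    constructor
    · intro hfJ
      obtain ⟨h, hsum, hle⟩ := exists_standard_representation mo hBJ
        (fun f hf hf0 => hspan ▸ Ideal.subset_span ⟨f, hf, hf0, rfl⟩) f hfJ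
      refine ⟨1, h, isUnit_one, by simpa using hsum,
        fun b hb => (support_add_lmon_le_iff mo).mp (hle b hb), fun hf0 => ?_⟩
      by_contra! hne
      refine lcoeff_ne_zero mo hf0 ?_
      have hc := congrArg (coeff (lmon mo f)) hsum
      rw [coeff_sum] at hc
      refine hc.trans (Finset.sum_eq_zero fun b hb => ?_)
      refine coeff_mul_eq_zero_of_add_lmon_ne mo (hle b hb) fun t ht hta => ?_
      have hb0 : h b ≠ 0 := by
        intro h0
        simp [h0] at ht
      refine hne b hb hb0 (mo.lin.le_antisymm _ _ (hle b hb _ (lmon_mem_support mo hb0)) ?_)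
      rw [← hta]
      exact mo.add_le_add (le_lmon mo ht) (mo.lin.le_refl _)
    · rintro ⟨lam, h, ⟨u, rfl⟩, hsum, -, -⟩
      have hmem : C (u : R) * f ∈ J :=
        hsum ▸ sum_mem fun b hb => J.mul_mem_left _ (hBJ b hb)
      exact (Ideal.unit_mul_mem_iff_mem J (u.isUnit.map C)).mp hmem
  · intro hrep
    refine le_antisymm (Ideal.span_le.mpr ?_) (Ideal.span_mono ?_)
    · rintro _ ⟨f, hfJ, -, rfl⟩
      obtain ⟨lam, h, hlam, hsum, hle, -⟩ := (hrep f).mp hfJ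
      exact lterm_mem_span_of_representation mo hlam hsum
        fun b hb => (support_add_lmon_le_iff mo).mpr (hle b hb)
    · rintro _ ⟨b, hb, rfl⟩
      exact ⟨b, hBJ b hb, hB0 b hb, rfl⟩

end LeadingTerms

/-- Characterization of bases over `R̄ = K[x₁]/⟨q⟩`: for an ideal `J` of `R̄[x̃]` and a
finite set `B ⊆ J` of nonconstant polynomials, the identity of leading-term ideals
`⟨lt(J \ {0})⟩ = ⟨lt(B)⟩` holds if and only if, for every polynomial `f`, membership
`f ∈ J` is equivalent to the existence of a gcd-reduction of `f` to zero by `B`: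
`λ·f = Σ h_j·b_j` with `λ` a unit and `lm f = max_j lm(h_j)·lm(b_j)` over the nonzero
`h_j`. -/
theorem leadTerm_span_eq_iff_mem_iff_gcdReduction_to_zero {K : Type*} [Field K]
    (q : Polynomial K) (hq : 0 < q.natDegree)
    (mo : MonomialOrdering m)
    (J : Ideal (MvPolynomial (Fin m) (Polynomial K ⧸ Ideal.span {q})))
    (B : Finset (MvPolynomial (Fin m) (Polynomial K ⧸ Ideal.span {q})))
    (hBne : B.Nonempty) (hBJ : ∀ b ∈ B, b ∈ J) (hBnc : ∀ b ∈ B, Nonconst b) :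
    (Ideal.span {p : MvPolynomial (Fin m) (Polynomial K ⧸ Ideal.span {q}) |
        ∃ f ∈ J, f ≠ 0 ∧ p = lterm mo f}
      = Ideal.span ((fun b => lterm mo b) ''
          (↑B : Set (MvPolynomial (Fin m) (Polynomial K ⧸ Ideal.span {q}))))) ↔
    (∀ f : MvPolynomial (Fin m) (Polynomial K ⧸ Ideal.span {q}),
      f ∈ J ↔
        ∃ (lam : Polynomial K ⧸ Ideal.span {q})
          (h : MvPolynomial (Fin m) (Polynomial K ⧸ Ideal.span {q}) →
            MvPolynomial (Fin m) (Polynomial K ⧸ Ideal.span {q})),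
          IsUnit lam ∧
          MvPolynomial.C lam * f = ∑ b ∈ B, h b * b ∧
          (∀ b ∈ B, h b ≠ 0 → mo.lin.le (lmon mo (h b) + lmon mo b) (lmon mo f)) ∧
          (f ≠ 0 → ∃ b ∈ B, h b ≠ 0 ∧ lmon mo (h b) + lmon mo b = lmon mo f)) := by
  exact lterm_span_eq_iff_mem_iff_representation mo J B hBJ fun b hb h0 =>
    hBnc b hb 0 (h0.trans C_0.symm)
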